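/- arXiv:2109.09688 — 3 statements merged into one kernel-verified Lean document; each statement's English description precedes it below -/
import Mathlib

section
/- Let B be a nonempty finite index set with n := card B, let a, p : B → ℝ satisfy a(β) > 0 and p(β) > 0 for all β ∈ B, and let T > 0 satisfy p(β) ≥ a(β)·T for all β ∈ B with p(γ) = a(γ)·T for some γ ∈ B. Set P_β(t) := p(β) − a(β)·t and R(t) := Σ_{β∈B} a(β)/P_β(t). Then for every t with 0 ≤ t < T one has 1/(T − t) ≤ R(t) ≤ n/(T − t). -/
/-- For a nonempty finite index set `B` with `n = card B`, positive
`a p : B → ℝ`, and `T > 0` with `p β ≥ a β * T` for all `β` and equality for some `γ`,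
setting `P_β(t) = p β - a β * t` and `R(t) = ∑ β, a β / P_β t`, for every `0 ≤ t < T`:
`1/(T - t) ≤ R(t) ≤ n/(T - t)`. -/
theorem statement_4 {B : Type*} [Fintype B] [Nonempty B]
    (n : ℕ) (hn : n = Fintype.card B)
    (a p : B → ℝ) (ha : ∀ β, 0 < a β) (hp : ∀ β, 0 < p β)
    (T : ℝ) (hT : 0 < T) (hpT : ∀ β, a β * T ≤ p β) (hγ : ∃ γ, p γ = a γ * T)
    (P : B → ℝ → ℝ) (hP : ∀ β t, P β t = p β - a β * t)
    (R : ℝ → ℝ) (hR : ∀ t, R t = ∑ β, a β / P β t) :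
    ∀ t : ℝ, 0 ≤ t → t < T →
      1 / (T - t) ≤ R t ∧ R t ≤ n / (T - t) := by
  intro t _ htT
  have hTt : 0 < T - t := sub_pos.2 htT
  have hle : ∀ β, a β * (T - t) ≤ P β t := fun β => by
    rw [hP]
    linarith [hpT β]
  have hPpos : ∀ β, 0 < P β t := fun β => (mul_pos (ha β) hTt).trans_le (hle β)
  rw [hR]
  constructor
  · obtain ⟨γ, hγ⟩ := hγ
    have hterm : 1 / (T - t) = a γ / P γ t := by
      rw [div_eq_div_iff hTt.ne' (hPpos γ).ne', hP, hγ]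
      ring
    rw [hterm]
    exact Finset.single_le_sum (f := fun β => a β / P β t)
      (fun β _ => (div_pos (ha β) (hPpos β)).le) (Finset.mem_univ γ)
  · calc ∑ β, a β / P β t ≤ ∑ _β : B, 1 / (T - t) := by
          refine Finset.sum_le_sum fun β _ => ?_
          rw [div_le_div_iff₀ (hPpos β) hTt, one_mul]
          exact hle β
      _ = n / (T - t) := by
          simp [hn, div_eq_mul_inv]
end

section
/- Let B be a nonempty finite index set with n := card B, let a, p : B → ℝ satisfy a(β) > 0 and p(β) > 0 for all β ∈ B, and let T > 0 satisfy p(β) ≥ a(β)·T for all β ∈ B with p(γ) = a(γ)·T for some γ ∈ B. Then for every t with 0 ≤ t < T one has (1 − t/T)^n ≤ Π_{β∈B} (p(β) − a(β)·t)/p(β) ≤ 1 − t/T. -/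
/-- For a nonempty finite index set `B` with `n = card B`, positive
`a p : B → ℝ`, and `T > 0` with `p β ≥ a β * T` for all `β` and equality for some `γ`,
for every `0 ≤ t < T`: `(1 - t/T)^n ≤ ∏ β, (p β - a β * t)/p β ≤ 1 - t/T`. -/
theorem statement_7 {B : Type*} [Fintype B] [Nonempty B]
    (n : ℕ) (hn : n = Fintype.card B)
    (a p : B → ℝ) (ha : ∀ β, 0 < a β) (hp : ∀ β, 0 < p β)
    (T : ℝ) (hT : 0 < T) (hpT : ∀ β, a β * T ≤ p β) (hγ : ∃ γ, p γ = a γ * T) :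
    ∀ t : ℝ, 0 ≤ t → t < T →
      (1 - t / T) ^ n ≤ ∏ β, (p β - a β * t) / p β ∧
      ∏ β, (p β - a β * t) / p β ≤ 1 - t / T := by
  intro t ht htT
  have hc : 0 ≤ 1 - t / T := sub_nonneg.2 ((div_le_one hT).2 htT.le)
  have lower (β : B) : 1 - t / T ≤ (p β - a β * t) / p β := by
    rw [sub_div, div_self (hp β).ne']
    refine sub_le_sub_left ?_ 1
    rw [div_le_div_iff₀ (hp β) hT]
    nlinarith [mul_le_mul_of_nonneg_right (hpT β) ht]
  have upper (β : B) : (p β - a β * t) / p β ≤ 1 := by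
    rw [div_le_one (hp β)]
    exact sub_le_self _ (mul_nonneg (ha β).le ht)
  have nonneg (β : B) : 0 ≤ (p β - a β * t) / p β := hc.trans (lower β)
  constructor
  · calc
      (1 - t / T) ^ n = ∏ _β : B, (1 - t / T) := by simp [hn]
      _ ≤ _ := Finset.prod_le_prod (fun _ _ => hc) fun β _ => lower β
  · classical
    obtain ⟨γ, hγ⟩ := hγ
    have hγ_eq : (p γ - a γ * t) / p γ = 1 - t / T := by
      rw [hγ, ← mul_sub, mul_div_mul_left _ _ (ha γ).ne', sub_div, div_self hT.ne']
    rw [← Finset.mul_prod_erase _ _ (Finset.mem_univ γ), hγ_eq]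
    exact mul_le_of_le_one_right hc
      (Finset.prod_le_one (fun β _ => nonneg β) fun β _ => upper β)
end

section
/- Let S and B be nonempty finite index sets with S ⊆ B and n := card B, let c, ℓ : S → ℝ satisfy c(α) > 0 and ℓ(α) > 0 for all α ∈ S, set T := min_{α∈S} c(α)/ℓ(α), and let m : S × B → ℝ satisfy: m(α,β) ≥ 0 for all α,β; a(β) := Σ_{α∈S} ℓ(α)·m(α,β) > 0 for every β ∈ B; and m(α,β) = 1 if α = β and m(α,β) = 0 if α ≠ β, whenever β ∈ S. Set P_β(t) := Σ_{α∈S} (c(α) − t·ℓ(α))·m(α,β) and R(t) := Σ_{β∈B} a(β)/P_β(t). Then for every t with 0 ≤ t < T one has 1/(T − t) ≤ R(t) ≤ n/(T − t). -/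
/-- Let `B` be a nonempty finite index set with `n = card B` and let
`S ⊆ B` be a nonempty subset. Let `c ℓ` be positive on `S`, `T = min_{α ∈ S} c α / ℓ α`,
and let `m` satisfy: `m α β ≥ 0` for `α ∈ S`, `a β = ∑_{α ∈ S} ℓ α * m α β > 0` for all
`β ∈ B`, and `m α β = δ_{αβ}` whenever `α, β ∈ S`. With
`P_β(t) = ∑_{α ∈ S} (c α - t * ℓ α) * m α β` and `R(t) = ∑_{β ∈ B} a β / P_β t`,
for every `0 ≤ t < T`: `1/(T - t) ≤ R(t) ≤ n/(T - t)`. -/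
theorem statement_11 {B : Type*} [Fintype B] [Nonempty B] [DecidableEq B]
    (n : ℕ) (hn : n = Fintype.card B)
    (S : Finset B) (hS : S.Nonempty)
    (c ℓ : B → ℝ) (hc : ∀ α ∈ S, 0 < c α) (hℓ : ∀ α ∈ S, 0 < ℓ α)
    (T : ℝ) (hT : T = S.inf' hS (fun α => c α / ℓ α))
    (m : B → B → ℝ) (hm : ∀ α ∈ S, ∀ β : B, 0 ≤ m α β)
    (a : B → ℝ) (ha : ∀ β, a β = ∑ α ∈ S, ℓ α * m α β) (ha' : ∀ β, 0 < a β)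
    (hkron : ∀ α ∈ S, ∀ β ∈ S, m α β = if α = β then 1 else 0)
    (P : B → ℝ → ℝ) (hP : ∀ β t, P β t = ∑ α ∈ S, (c α - t * ℓ α) * m α β)
    (R : ℝ → ℝ) (hR : ∀ t, R t = ∑ β, a β / P β t) :
    ∀ t : ℝ, 0 ≤ t → t < T →
      1 / (T - t) ≤ R t ∧ R t ≤ n / (T - t) := by
  intro t _ ht
  have hTt : 0 < T - t := sub_pos.mpr ht
  have h_lower : ∀ β, a β * (T - t) ≤ P β t := by
    intro β
    rw [ha, hP, Finset.sum_mul]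
    refine Finset.sum_le_sum fun α hα => ?_
    have h_min : T ≤ c α / ℓ α := hT ▸ Finset.inf'_le _ hα
    rw [le_div_iff₀ (hℓ α hα)] at h_min
    calc ℓ α * m α β * (T - t) = (T * ℓ α - t * ℓ α) * m α β := by ring
      _ ≤ (c α - t * ℓ α) * m α β := by
        have := hm α hα β
        gcongr
  have h_pos : ∀ β, 0 < P β t := fun β => (mul_pos (ha' β) hTt).trans_le (h_lower β)
  rw [hR]
  constructor
  · obtain ⟨γ, hγ, hγT⟩ := S.exists_mem_eq_inf' hS (fun α => c α / ℓ α)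
    have h_sum (f : B → ℝ) : ∑ α ∈ S, f α * m α γ = f γ := by
      rw [Finset.sum_congr rfl fun α hα => by rw [hkron α hα γ hγ]]
      simp [hγ]
    have haγ : a γ = ℓ γ := (ha γ).trans (h_sum ℓ)
    have hPγ : P γ t = ℓ γ * (T - t) := by
      rw [hP, h_sum fun α => c α - t * ℓ α, hT.trans hγT]
      have := (hℓ γ hγ).ne'
      field_simp
    have h_term : 1 / (T - t) = a γ / P γ t := by
      have := (hℓ γ hγ).ne'
      rw [haγ, hPγ]
      field_simp
    rw [h_term]
    exact Finset.single_le_sum (f := fun β => a β / P β t)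
      (fun β _ => (div_pos (ha' β) (h_pos β)).le) (Finset.mem_univ γ)
  · calc ∑ β, a β / P β t ≤ ∑ _β : B, 1 / (T - t) := by
          refine Finset.sum_le_sum fun β _ => ?_
          rw [div_le_div_iff₀ (h_pos β) hTt, one_mul]
          exact h_lower β
      _ = n / (T - t) := by
          rw [Finset.sum_const, Finset.card_univ, ← hn, nsmul_eq_mul, mul_one_div]
end
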